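/- There exists a real number that is not computable. -/

import Mathlib

/-- A real number is computable if some computable sequence of rationals
approximates it with error at most `(1/2)^n` at stage `n`. -/
def IsComputableReal (x : ℝ) : Prop :=
  ∃ f : ℕ → ℚ, Computable f ∧ ∀ n : ℕ, |x - (f n : ℝ)| ≤ (1 / 2 : ℝ) ^ n

theorem countable_setOf_computable {α β : Type*} [Primcodable α] [Primcodable β] :
    {f : α → β | Computable f}.Countable := by
  have hc : {g : ℕ →. ℕ | Nat.Partrec g}.Countable :=
    (Set.countable_range Nat.Partrec.Code.eval).mono fun _ hg => Nat.Partrec.Code.exists_code.1 hg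
  let F : (α → β) → (ℕ →. ℕ) := fun f n =>
    Part.bind (Encodable.decode (α := α) n) fun a => Part.some (Encodable.encode (f a))
  have hF : Function.Injective F := by
    intro f g h
    funext a
    have ha := congrFun h (Encodable.encode a)
    simpa [F] using ha
  refine (hc.preimage hF).mono fun f hf => ?_
  have hf' : Nat.Partrec _ := hf
  refine hf'.of_eq fun n => ?_
  simp [F, Part.map_some]

/-- A real number is determined by any sequence approximating it to within `(1/2)^n`. -/
theorem eq_of_forall_abs_sub_le_half_pow {x y : ℝ} {u : ℕ → ℝ}
    (hx : ∀ n, |x - u n| ≤ (1 / 2 : ℝ) ^ n) (hy : ∀ n, |y - u n| ≤ (1 / 2 : ℝ) ^ n) :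
    x = y := by
  have hlim : ∀ z : ℝ, (∀ n, |z - u n| ≤ (1 / 2 : ℝ) ^ n) →
      Filter.Tendsto u Filter.atTop (nhds z) := fun z hz => by
    refine tendsto_iff_dist_tendsto_zero.2 (squeeze_zero (fun _ => dist_nonneg) (fun n => ?_)
      (tendsto_pow_atTop_nhds_zero_of_lt_one (r := (1 / 2 : ℝ)) (by norm_num) (by norm_num)))
    rw [dist_comm, Real.dist_eq]
    exact hz n
  exact tendsto_nhds_unique (hlim x hx) (hlim y hy)

theorem countable_setOf_isComputableReal : {x : ℝ | IsComputableReal x}.Countable := by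
  have hsub : {x : ℝ | IsComputableReal x} ⊆ ⋃ f ∈ {f : ℕ → ℚ | Computable f},
      {x : ℝ | ∀ n : ℕ, |x - (f n : ℝ)| ≤ (1 / 2 : ℝ) ^ n} := by
    rintro x ⟨f, hf, hx⟩
    exact Set.mem_biUnion hf hx
  refine (countable_setOf_computable.biUnion fun f _ => ?_).mono hsub
  exact Set.Subsingleton.countable fun x hx y hy => eq_of_forall_abs_sub_le_half_pow hx hy

/-- There exists an uncomputable real number (Turing 1936). -/
theorem exists_uncomputable_real : ∃ x : ℝ, ¬ IsComputableReal x := by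
  by_contra! h
  exact Cardinal.not_countable_real
    (countable_setOf_isComputableReal.mono fun x _ => h x)
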